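/- arXiv:2511.10226 — 3 statements merged into one kernel-verified Lean document; each statement's English description precedes it below -/
import Mathlib

section
/- Let Θ = {θ_1, …, θ_J} be a finite set with J ≥ 2, G a connected simple graph on Θ, ε > 0, and μ0 a full-support prior. A matrix W = (w_{ij})_{i,j=1}^J ∈ ℝ^{J×J} equals the matrix associated to some μ ∈ M if and only if: (i) |w_{ij}| ≤ 1 for every edge {θ_i, θ_j} of G; (ii) w_{ij} = −w_{ji} for all i, j ∈ {1,…,J}; and (iii) for every finite sequence of indices j_1, j_2, …, j_r ∈ {1,…,J}, w_{j_1 j_r} = Σ_{r'=1}^{r−1} w_{j_{r'} j_{r'+1}}. -/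
noncomputable section

open Finset

/-- `μ` is a probability distribution on the finite type `V`. -/
def IsDist {V : Type*} [Fintype V] (μ : V → ℝ) : Prop :=
  (∀ v, 0 ≤ μ v) ∧ ∑ v, μ v = 1

/-- The feasible posterior set `M` for the graph-based inferential privacy constraint:
distributions `μ` with `μ(θᵢ)·μ₀(θⱼ) ≤ e^ε·μ(θⱼ)·μ₀(θᵢ)` for every edge of `G`. -/
def FeasibleSet {V : Type*} [Fintype V] (G : SimpleGraph V) (ε : ℝ) (μ0 : V → ℝ) :
    Set (V → ℝ) :=
  {μ | IsDist μ ∧ ∀ i j : V, G.Adj i j → μ i * μ0 j ≤ Real.exp ε * (μ j * μ0 i)}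

/-- The matrix `W` associated to a posterior `μ` (relative to the prior `μ0`):
`w_{ij} = (ln μ(θⱼ) − ln μ₀(θⱼ) − ln μ(θᵢ) + ln μ₀(θᵢ)) / ε`. -/
def assocW {V : Type*} (ε : ℝ) (μ0 μ : V → ℝ) (i j : V) : ℝ :=
  (Real.log (μ j) - Real.log (μ0 j) - Real.log (μ i) + Real.log (μ0 i)) / ε

/-- `μ` is an extreme point of `M`: it lies in `M` and cannot be written as a proper
convex combination of two distinct elements of `M`. -/
def IsExtremePt {V : Type*} (M : Set (V → ℝ)) (μ : V → ℝ) : Prop :=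
  μ ∈ M ∧ ¬ ∃ μ' μ'' : V → ℝ, μ' ∈ M ∧ μ'' ∈ M ∧ μ' ≠ μ'' ∧
    ∃ α : ℝ, 0 < α ∧ α < 1 ∧ μ = fun v => α * μ' v + (1 - α) * μ'' v

/-- The privacy constraint between two points, in logarithmic form. -/
lemma mul_le_exp_mul_iff_log {ε a b x y : ℝ} (ha : 0 < a) (hb : 0 < b) (hx : 0 < x)
    (hy : 0 < y) :
    x * b ≤ Real.exp ε * (y * a) ↔
      Real.log x + Real.log b ≤ ε + (Real.log y + Real.log a) := by
  rw [← Real.log_le_log_iff (by positivity) (by positivity), Real.log_mul hx.ne' hb.ne',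
    Real.log_mul (Real.exp_pos ε).ne' (by positivity), Real.log_exp,
    Real.log_mul hy.ne' ha.ne']

/-- On a connected graph, every feasible posterior has full support. -/
lemma pos_of_mem_feasibleSet {V : Type*} [Fintype V] {G : SimpleGraph V} (hG : G.Connected)
    {ε : ℝ} {μ0 μ : V → ℝ} (hμ0pos : ∀ v, 0 < μ0 v) (hμ : μ ∈ FeasibleSet G ε μ0) (v : V) :
    0 < μ v := by
  obtain ⟨⟨hnn, hsum⟩, hadj⟩ := hμ
  obtain ⟨u, -, hu⟩ : ∃ u ∈ univ, 0 < μ u :=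
    exists_lt_of_sum_lt (by simp [hsum])
  obtain ⟨p⟩ := hG.preconnected u v
  induction p with
  | nil => exact hu
  | @cons a b c hab _ ih =>
    refine ih ((hnn b).lt_of_ne fun hb => ?_)
    have h := hadj a b hab
    rw [← hb] at h
    simp only [zero_mul, mul_zero] at h
    exact absurd h (mul_pos hu (hμ0pos b)).not_ge

/-- Posteriors with full support satisfy the privacy constraints exactly when the associated
matrix is bounded by one on edges. -/
lemma forall_adj_mul_le_iff_abs_assocW_le_one {V : Type*} (G : SimpleGraph V) {ε : ℝ}
    (hε : 0 < ε) {μ0 μ : V → ℝ} (hμ0 : ∀ v, 0 < μ0 v) (hμ : ∀ v, 0 < μ v) :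
    (∀ i j : V, G.Adj i j → μ i * μ0 j ≤ Real.exp ε * (μ j * μ0 i)) ↔
      ∀ i j : V, G.Adj i j → |assocW ε μ0 μ i j| ≤ 1 := by
  simp only [mul_le_exp_mul_iff_log (hμ0 _) (hμ0 _) (hμ _) (hμ _), assocW, abs_le,
    le_div_iff₀ hε, div_le_iff₀ hε]
  constructor
  · intro h i j hij
    have h1 := h i j hij
    have h2 := h j i hij.symm
    constructor <;> linarith
  · intro h i j hij
    have h1 := (h i j hij).1
    linarith

/-- The associated matrix telescopes along finite sequences. -/
lemma assocW_eq_sum {V : Type*} (ε : ℝ) (μ0 μ : V → ℝ) (r : ℕ) (f : Fin (r + 1) → V) :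
    assocW ε μ0 μ (f 0) (f (Fin.last r)) =
      ∑ k : Fin r, assocW ε μ0 μ (f k.castSucc) (f k.succ) := by
  induction r with
  | zero => simp [assocW]
  | succ r ih =>
    rw [Fin.sum_univ_castSucc]
    have h := ih fun k => f k.castSucc
    simp only [Fin.castSucc_zero] at h
    simp only [← Fin.castSucc_succ] at h ⊢
    rw [← h, Fin.succ_last]
    unfold assocW
    ring

/-- Lemma: characterization of feasible `W` matrices.
A matrix `W` equals the matrix associated to some `μ ∈ M` if and only if:
(i) `|w_{ij}| ≤ 1` on every edge of `G`; (ii) `w_{ij} = −w_{ji}`;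
(iii) `w_{j₁ j_r} = ∑ w_{j_{r'} j_{r'+1}}` along every finite sequence of indices. -/
theorem stmt_0 {V : Type*} [Fintype V] [DecidableEq V]
    (hV : 2 ≤ Fintype.card V) (G : SimpleGraph V) (hG : G.Connected)
    (ε : ℝ) (hε : 0 < ε) (μ0 : V → ℝ) (hμ0 : IsDist μ0) (hμ0pos : ∀ v, 0 < μ0 v)
    (W : V → V → ℝ) :
    (∃ μ ∈ FeasibleSet G ε μ0, ∀ i j : V, W i j = assocW ε μ0 μ i j) ↔
      ((∀ i j : V, G.Adj i j → |W i j| ≤ 1) ∧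
        (∀ i j : V, W i j = - W j i) ∧
        (∀ (r : ℕ) (f : Fin (r + 1) → V),
          W (f 0) (f (Fin.last r)) = ∑ k : Fin r, W (f k.castSucc) (f k.succ))) := by
  constructor
  · rintro ⟨μ, hμ, hW⟩
    simp only [hW]
    refine ⟨(forall_adj_mul_le_iff_abs_assocW_le_one G hε hμ0pos
      (pos_of_mem_feasibleSet hG hμ0pos hμ)).1 hμ.2, fun i j => ?_, assocW_eq_sum ε μ0 μ⟩
    unfold assocW
    ring
  · rintro ⟨hedge, -, hsum⟩
    have htri (i j k : V) : W i k = W i j + W j k := by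
      have h := hsum 2 ![i, j, k]
      simpa [Fin.sum_univ_two] using h
    obtain ⟨o⟩ := hG.nonempty
    set Z : ℝ := ∑ v, μ0 v * Real.exp (ε * W o v) with hZ
    have hZpos : 0 < Z :=
      sum_pos (fun v _ => mul_pos (hμ0pos v) (Real.exp_pos _)) ⟨o, mem_univ o⟩
    let μ : V → ℝ := fun v => μ0 v * Real.exp (ε * W o v) / Z
    have hμpos (v : V) : 0 < μ v :=
      div_pos (mul_pos (hμ0pos v) (Real.exp_pos _)) hZpos
    have hlog (v : V) : Real.log (μ v) = Real.log (μ0 v) + ε * W o v - Real.log Z := by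
      rw [Real.log_div (mul_pos (hμ0pos v) (Real.exp_pos _)).ne' hZpos.ne',
        Real.log_mul (hμ0pos v).ne' (Real.exp_pos _).ne', Real.log_exp]
    have hW (i j : V) : W i j = assocW ε μ0 μ i j := by
      rw [assocW, hlog, hlog, eq_div_iff hε.ne', htri o i j]
      ring
    refine ⟨μ, ⟨⟨fun v => (hμpos v).le, ?_⟩, ?_⟩, hW⟩
    · rw [← sum_div, ← hZ, div_self hZpos.ne']
    · rw [forall_adj_mul_le_iff_abs_assocW_le_one G hε hμ0pos hμpos]
      simpa only [← hW] using hedge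
end
end

section
/- Let μ ∈ M with associated matrix W. Then μ is an extreme point of M if and only if there exists a spanning tree T of G such that |w_{ij}| = 1 for every edge {θ_i, θ_j} of T. -/
noncomputable section

open Finset

/-- A predicate preserved along edges of a connected graph holds everywhere once it holds at
one vertex. -/
theorem SimpleGraph.Reachable.of_forall_adj {V : Type*} {G : SimpleGraph V} {P : V → Prop}
    (hP : ∀ i j, G.Adj i j → P i → P j) {u v : V} (h : G.Reachable u v) (hu : P u) : P v := by
  obtain ⟨p⟩ := h
  induction p with
  | nil => exact hu
  | cons hadj _ ih => exact ih (hP _ _ hadj hu)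

theorem IsDist.exists_pos {V : Type*} [Fintype V] {μ : V → ℝ} (hμ : IsDist μ) : ∃ v, 0 < μ v := by
  by_contra! h
  have := Finset.sum_nonpos fun v (_ : v ∈ univ) => h v
  linarith [hμ.2]

theorem FeasibleSet.pos {V : Type*} [Fintype V] {G : SimpleGraph V} (hG : G.Connected)
    {ε : ℝ} {μ0 : V → ℝ} (hμ0 : ∀ v, 0 < μ0 v) {μ : V → ℝ} (hμ : μ ∈ FeasibleSet G ε μ0)
    (v : V) : 0 < μ v := by
  obtain ⟨u, hu⟩ := hμ.1.exists_pos
  refine (hG u v).of_forall_adj (P := fun v => 0 < μ v) (fun i j hij hi => ?_) hu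
  have h : 0 < Real.exp ε * (μ j * μ0 i) := (mul_pos hi (hμ0 j)).trans_le (hμ.2 i j hij)
  exact pos_of_mul_pos_left (pos_of_mul_pos_right h (Real.exp_pos ε).le) (hμ0 i).le

theorem assocW_swap {V : Type*} (ε : ℝ) (μ0 μ : V → ℝ) (i j : V) :
    assocW ε μ0 μ j i = -assocW ε μ0 μ i j := by
  unfold assocW
  ring

theorem assocW_eq_one_iff {V : Type*} {ε : ℝ} (hε : 0 < ε) {μ0 μ : V → ℝ}
    (hμ0 : ∀ v, 0 < μ0 v) (hμ : ∀ v, 0 < μ v) (i j : V) :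
    assocW ε μ0 μ i j = 1 ↔ μ j * μ0 i = Real.exp ε * (μ i * μ0 j) := by
  have hi := hμ i
  have hj := hμ j
  have hi0 := hμ0 i
  have hj0 := hμ0 j
  rw [← Real.log_injOn_pos.eq_iff (x := μ j * μ0 i) (Set.mem_Ioi.2 (by positivity))
      (Set.mem_Ioi.2 (by positivity)),
    Real.log_mul hj.ne' hi0.ne', Real.log_mul (Real.exp_pos ε).ne' (by positivity),
    Real.log_mul hi.ne' hj0.ne', Real.log_exp, assocW, div_eq_one_iff_eq hε.ne']
  constructor <;> intro h <;> linarith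

theorem abs_assocW_eq_one_iff {V : Type*} (ε : ℝ) (μ0 μ : V → ℝ) (i j : V) :
    |assocW ε μ0 μ i j| = 1 ↔ assocW ε μ0 μ i j = 1 ∨ assocW ε μ0 μ j i = 1 := by
  rw [assocW_swap ε μ0 μ i j, abs_eq zero_le_one, neg_eq_iff_eq_neg]

/-- The subgraph of `G` consisting of the edges whose constraint binds at `μ`. -/
def tightGraph {V : Type*} (G : SimpleGraph V) (ε : ℝ) (μ0 μ : V → ℝ) : SimpleGraph V where
  Adj i j := G.Adj i j ∧ |assocW ε μ0 μ i j| = 1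
  symm := ⟨fun i j h => ⟨h.1.symm, by rw [assocW_swap, abs_neg]; exact h.2⟩⟩
  loopless := ⟨fun i h => G.loopless.irrefl i h.1⟩

/-- A constraint binding at a proper convex combination of feasible points binds at each of them,
so the ratio of likelihoods across that edge is the same. -/
theorem FeasibleSet.cross_mul_eq {V : Type*} [Fintype V] {G : SimpleGraph V} {ε : ℝ}
    {μ0 : V → ℝ} (hμ0 : ∀ v, 0 < μ0 v) {μ' μ'' : V → ℝ} (h' : μ' ∈ FeasibleSet G ε μ0)
    (h'' : μ'' ∈ FeasibleSet G ε μ0) {α : ℝ} (hα : 0 < α) (hα1 : α < 1) {μ : V → ℝ}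
    (hμ : μ = fun v => α * μ' v + (1 - α) * μ'' v) {i j : V} (hij : G.Adj i j)
    (ht : μ i * μ0 j = Real.exp ε * (μ j * μ0 i)) : μ' i * μ j = μ' j * μ i := by
  have h1 := h'.2 i j hij
  have h2 := h''.2 i j hij
  have h3 : α * (Real.exp ε * (μ' j * μ0 i) - μ' i * μ0 j)
      + (1 - α) * (Real.exp ε * (μ'' j * μ0 i) - μ'' i * μ0 j) = 0 := by
    simp only [hμ] at ht
    linear_combination -ht
  have h4 := mul_nonneg hα.le (sub_nonneg.2 h1)
  have h5 := mul_nonneg (sub_pos.2 hα1).le (sub_nonneg.2 h2)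
  have h6 : Real.exp ε * (μ' j * μ0 i) - μ' i * μ0 j = 0 :=
    (mul_eq_zero.1 (by linarith : α * (Real.exp ε * (μ' j * μ0 i) - μ' i * μ0 j) = 0)).resolve_left
      hα.ne'
  have hne : Real.exp ε * μ0 i * μ0 j ≠ 0 :=
    (mul_pos (mul_pos (Real.exp_pos ε) (hμ0 i)) (hμ0 j)).ne'
  apply mul_right_cancel₀ hne
  linear_combination Real.exp ε * μ0 i * μ' j * (-ht) - Real.exp ε * μ0 i * μ j * h6

theorem FeasibleSet.eq_of_connected {V : Type*} [Fintype V] {G T : SimpleGraph V}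
    (hT : T.Connected) (hTG : T ≤ G) {ε : ℝ} (hε : 0 < ε) {μ0 : V → ℝ} (hμ0 : ∀ v, 0 < μ0 v)
    {μ' μ'' : V → ℝ} (h' : μ' ∈ FeasibleSet G ε μ0) (h'' : μ'' ∈ FeasibleSet G ε μ0) {α : ℝ}
    (hα : 0 < α) (hα1 : α < 1) {μ : V → ℝ} (hμM : μ ∈ FeasibleSet G ε μ0)
    (hμ : μ = fun v => α * μ' v + (1 - α) * μ'' v)
    (hw : ∀ i j, T.Adj i j → |assocW ε μ0 μ i j| = 1) : μ' = μ := by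
  have hpos := FeasibleSet.pos (hT.mono hTG) hμ0 hμM
  have hstep : ∀ i j, T.Adj i j → μ' i * μ j = μ' j * μ i := by
    intro i j hij
    rcases (abs_assocW_eq_one_iff ε μ0 μ i j).1 (hw i j hij) with h | h <;>
      rw [assocW_eq_one_iff hε hμ0 hpos] at h
    · exact (FeasibleSet.cross_mul_eq hμ0 h' h'' hα hα1 hμ (hTG hij).symm h).symm
    · exact FeasibleSet.cross_mul_eq hμ0 h' h'' hα hα1 hμ (hTG hij) h
  have hprop : ∀ u v, μ' v * μ u = μ' u * μ v := by
    intro u v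
    refine (hT u v).of_forall_adj (P := fun v => μ' v * μ u = μ' u * μ v) (fun i j hij hi => ?_) rfl
    apply mul_right_cancel₀ (hpos i).ne'
    linear_combination μ j * hi - μ u * hstep i j hij
  funext u
  have h := Finset.sum_congr rfl fun v (_ : v ∈ univ) => hprop u v
  rw [← Finset.sum_mul, ← Finset.mul_sum, h'.1.2, hμM.1.2] at h
  linarith

/-- If the tight graph is disconnected, shifting mass proportionally between one of its components
and the rest stays feasible for small shifts in either direction. -/
theorem FeasibleSet.not_isExtremePt {V : Type*} [Fintype V] {G : SimpleGraph V}
    (hG : G.Connected) {ε : ℝ} (hε : 0 < ε) {μ0 : V → ℝ} (hμ0 : ∀ v, 0 < μ0 v) {μ : V → ℝ}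
    (hμ : μ ∈ FeasibleSet G ε μ0) (hH : ¬ (tightGraph G ε μ0 μ).Connected) :
    ¬ IsExtremePt (FeasibleSet G ε μ0) μ := by
  classical
  have hpos := FeasibleSet.pos hG hμ0 hμ
  obtain ⟨a, b, hab⟩ : ∃ a b, ¬ (tightGraph G ε μ0 μ).Reachable a b := by
    by_contra! h
    exact hH ((SimpleGraph.connected_iff _).2 ⟨h, hG.nonempty⟩)
  let χ : V → ℝ := fun v => if (tightGraph G ε μ0 μ).Reachable a v then 1 else 0
  let m : ℝ := ∑ v, χ v * μ v
  let ν : ℝ → V → ℝ := fun t v => (1 + t * (χ v - m)) * μ v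
  have hsum (t : ℝ) : ∑ v, ν t v = 1 := by
    have : ∀ v, ν t v = (1 - t * m) * μ v + t * (χ v * μ v) := fun v => by simp only [ν]; ring
    simp_rw [this]
    rw [Finset.sum_add_distrib, ← Finset.mul_sum, ← Finset.mul_sum, hμ.1.2]
    change (1 - t * m) * 1 + t * m = 1
    ring
  have hcont (v : V) : Continuous fun t => ν t v := by simp only [ν]; fun_prop
  have hν0 (v : V) : ν 0 v = μ v := by simp [ν]
  have hfac : ∀ᶠ t in nhds (0 : ℝ), ∀ v, 0 < ν t v := by
    refine Filter.eventually_all.2 fun v => ?_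
    exact (hcont v).continuousAt.eventually_const_lt ((hpos v).trans_eq (hν0 v).symm)
  have hcross : ∀ᶠ t in nhds (0 : ℝ), ∀ i j, G.Adj i j → χ i ≠ χ j →
      ν t i * μ0 j < Real.exp ε * (ν t j * μ0 i) := by
    refine Filter.eventually_all.2 fun i => Filter.eventually_all.2 fun j => ?_
    by_cases hij : G.Adj i j
    swap
    · exact Filter.Eventually.of_forall fun t h => absurd h hij
    by_cases hχ : χ i = χ j
    · exact Filter.Eventually.of_forall fun t _ h => absurd hχ h
    have hne : μ i * μ0 j ≠ Real.exp ε * (μ j * μ0 i) := by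
      intro h
      have hadj : (tightGraph G ε μ0 μ).Adj i j := ⟨hij, (abs_assocW_eq_one_iff ε μ0 μ i j).2
        (Or.inr ((assocW_eq_one_iff hε hμ0 hpos j i).2 h))⟩
      have hiff : (tightGraph G ε μ0 μ).Reachable a i ↔ (tightGraph G ε μ0 μ).Reachable a j :=
        ⟨fun h => h.trans hadj.reachable, fun h => h.trans hadj.symm.reachable⟩
      exact hχ (by simp only [χ, hiff])
    have hev := ContinuousAt.eventually_lt (x₀ := (0 : ℝ))
      (((hcont i).mul_const (μ0 j)).continuousAt)
      ((((hcont j).mul_const (μ0 i)).const_mul (Real.exp ε)).continuousAt)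
      (by rw [hν0, hν0]; exact lt_of_le_of_ne (hμ.2 i j hij) hne)
    exact hev.mono fun t ht _ _ => ht
  have hfeas : ∀ᶠ t in nhds (0 : ℝ), ν t ∈ FeasibleSet G ε μ0 := by
    filter_upwards [hfac, hcross] with t h1 h2
    refine ⟨⟨fun v => (h1 v).le, hsum t⟩, fun i j hij => ?_⟩
    by_cases hχ : χ i = χ j
    · have hc : 0 ≤ 1 + t * (χ j - m) := (pos_of_mul_pos_left (h1 j) (hpos j).le).le
      have := mul_le_mul_of_nonneg_left (hμ.2 i j hij) hc
      simp only [ν, hχ]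
      linarith
    · exact (h2 i j hij hχ).le
  have hneg : ∀ᶠ t in nhds (0 : ℝ), ν (-t) ∈ FeasibleSet G ε μ0 :=
    (continuous_neg.tendsto' (0 : ℝ) 0 neg_zero).eventually hfeas
  obtain ⟨r, hr, hball⟩ := Metric.eventually_nhds_iff.1 (hfeas.and hneg)
  obtain ⟨h1, h2⟩ := hball (y := r / 2) (by rw [Real.dist_eq, sub_zero, abs_of_pos] <;> linarith)
  refine fun hext => hext.2 ⟨_, _, h1, h2, fun heq => ?_, 1 / 2, by norm_num, by norm_num, ?_⟩
  · have key : ∀ v, χ v = m := by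
      intro v
      have hv := mul_right_cancel₀ (hpos v).ne' (congrFun heq v)
      have : r * (χ v - m) = 0 := by linear_combination hv
      exact sub_eq_zero.1 ((mul_eq_zero.1 this).resolve_left hr.ne')
    have ha : χ a = 1 := if_pos (SimpleGraph.Reachable.refl a)
    have hb : χ b = 0 := if_neg hab
    linarith [key a, key b]
  · funext v
    simp only [ν]
    ring

/-- Lemma: extreme points and spanning trees.
`μ ∈ M` is an extreme point of `M` if and only if there exists a spanning tree `T`
of `G` (a connected acyclic subgraph of `G`, on all nodes) with `|w_{ij}| = 1` for
every edge of `T`. -/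
theorem stmt_1 {V : Type*} [Fintype V] [DecidableEq V]
    (hV : 2 ≤ Fintype.card V) (G : SimpleGraph V) (hG : G.Connected)
    (ε : ℝ) (hε : 0 < ε) (μ0 : V → ℝ) (hμ0 : IsDist μ0) (hμ0pos : ∀ v, 0 < μ0 v)
    (μ : V → ℝ) (hμ : μ ∈ FeasibleSet G ε μ0) :
    IsExtremePt (FeasibleSet G ε μ0) μ ↔
      ∃ T : SimpleGraph V, T ≤ G ∧ T.Connected ∧ T.IsAcyclic ∧
        ∀ i j : V, T.Adj i j → |assocW ε μ0 μ i j| = 1 := by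
  constructor
  · intro hext
    have hH : (tightGraph G ε μ0 μ).Connected := by
      by_contra hH
      exact FeasibleSet.not_isExtremePt hG hε hμ0pos hμ hH hext
    obtain ⟨T, hT, htree⟩ := hH.exists_isTree_le
    exact ⟨T, fun i j h => (hT h).1, htree.1, htree.2, fun i j h => (hT h).2⟩
  · rintro ⟨T, hTG, hT, -, hw⟩
    refine ⟨hμ, ?_⟩
    rintro ⟨μ', μ'', h', h'', hne, α, hα, hα1, heq⟩
    have e' := FeasibleSet.eq_of_connected hT hTG hε hμ0pos h' h'' hα hα1 hμ heq hw
    have e'' := FeasibleSet.eq_of_connected hT hTG hε hμ0pos h'' h' (sub_pos.2 hα1)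
      (sub_lt_self 1 hα) hμ (by rw [heq]; funext v; ring) hw
    exact hne (e'.trans e''.symm)
end
end

section
/- Let G* be the complete graph on Θ. A distribution μ ∈ Δ(Θ) is an extreme point of the feasible posterior set M for G* if and only if there exists an ordered partition (Θ_1, Θ_2) of Θ into two nonempty sets such that μ(θ) = e^ε·μ0(θ) / (e^ε·μ0(Θ_1) + μ0(Θ_2)) for every θ ∈ Θ_1 and μ(θ) = μ0(θ) / (e^ε·μ0(Θ_1) + μ0(Θ_2)) for every θ ∈ Θ_2. -/
noncomputable section

open Finset

section

variable {V : Type*} [Fintype V]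

/-- Feasibility for the complete graph bounds every pair of ratios `μ / μ₀`. -/
lemma div_le_of_mem_feasibleSet_top {ε : ℝ} (hε : 0 < ε) {μ0 μ : V → ℝ}
    (hpos : ∀ v, 0 < μ0 v) (h : μ ∈ FeasibleSet (⊤ : SimpleGraph V) ε μ0) (i j : V) :
    μ i / μ0 i ≤ Real.exp ε * (μ j / μ0 j) := by
  by_cases hij : i = j
  · subst hij
    exact le_mul_of_one_le_left (div_nonneg (h.1.1 i) (hpos i).le) (Real.one_le_exp hε.le)
  · have := h.2 i j (by simpa using hij)
    rw [← mul_div_assoc, div_le_div_iff₀ (hpos i) (hpos j)]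
    linarith

lemma pos_of_mem_feasibleSet_top {ε : ℝ} {μ0 μ : V → ℝ}
    (hpos : ∀ v, 0 < μ0 v) (h : μ ∈ FeasibleSet (⊤ : SimpleGraph V) ε μ0) (j : V) :
    0 < μ j := by
  obtain ⟨i, -, hi⟩ : ∃ i ∈ Finset.univ, 0 < μ i := by
    by_contra! hn
    have := Finset.sum_nonpos hn
    linarith [h.1.2]
  by_cases hij : i = j
  · exact hij ▸ hi
  have h1 := h.2 i j (by simpa using hij)
  have h2 : 0 < Real.exp ε * (μ j * μ0 i) := (mul_pos hi (hpos j)).trans_le h1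
  exact pos_of_mul_pos_left (pos_of_mul_pos_right h2 (Real.exp_pos ε).le) (hpos i).le

variable [DecidableEq V]

/-- A distribution whose ratio to `μ₀` is `c` times larger on `A` than on `B` is determined by
the ordered partition `(A, B)`. -/
lemma eq_of_ratio_eq {c : ℝ} (hc : 0 < c) {μ0 ν : V → ℝ} (hpos : ∀ v, 0 < μ0 v)
    (hν : IsDist ν) {A B : Finset V} (hA : A.Nonempty) (hB : B.Nonempty) (hAB : Disjoint A B)
    (hU : A ∪ B = Finset.univ)
    (h : ∀ a ∈ A, ∀ b ∈ B, ν a / μ0 a = c * (ν b / μ0 b)) :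
    (∀ a ∈ A, ν a = c * μ0 a / (c * ∑ v ∈ A, μ0 v + ∑ v ∈ B, μ0 v)) ∧
      ∀ b ∈ B, ν b = μ0 b / (c * ∑ v ∈ A, μ0 v + ∑ v ∈ B, μ0 v) := by
  obtain ⟨a₀, ha₀⟩ := hA
  obtain ⟨b₀, hb₀⟩ := hB
  set k := ν b₀ / μ0 b₀ with hk
  have hνA : ∀ a ∈ A, ν a = k * (c * μ0 a) := fun a ha => by
    have := h a ha b₀ hb₀
    rw [div_eq_iff (hpos a).ne'] at this
    rw [this]; ring
  have hνB : ∀ b ∈ B, ν b = k * μ0 b := fun b hb => by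
    have := (h a₀ ha₀ b hb).symm.trans (h a₀ ha₀ b₀ hb₀)
    rw [← div_eq_iff (hpos b).ne']
    exact mul_left_cancel₀ hc.ne' this
  have hD : 0 < c * ∑ v ∈ A, μ0 v + ∑ v ∈ B, μ0 v :=
    add_pos (mul_pos hc (Finset.sum_pos (fun v _ => hpos v) ⟨a₀, ha₀⟩))
      (Finset.sum_pos (fun v _ => hpos v) ⟨b₀, hb₀⟩)
  have hsum : k * (c * ∑ v ∈ A, μ0 v + ∑ v ∈ B, μ0 v) = 1 := by
    rw [← hν.2, ← hU, Finset.sum_union hAB, Finset.sum_congr rfl hνA, Finset.sum_congr rfl hνB,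
      ← Finset.mul_sum, ← Finset.mul_sum, ← Finset.mul_sum]
    ring
  refine ⟨fun a ha => ?_, fun b hb => ?_⟩
  · rw [eq_div_iff hD.ne', hνA a ha]
    linear_combination (c * μ0 a) * hsum
  · rw [eq_div_iff hD.ne', hνB b hb]
    linear_combination μ0 b * hsum

/-- Adding mass `δ` at `v` and renormalizing. -/
def addMass (μ : V → ℝ) (v : V) (δ : ℝ) (w : V) : ℝ :=
  (μ w + if w = v then δ else 0) / (1 + δ)

lemma addMass_mem_feasibleSet {ε δ : ℝ} {μ0 μ : V → ℝ} {v : V}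
    (h : μ ∈ FeasibleSet (⊤ : SimpleGraph V) ε μ0) (hδ : 0 < 1 + δ) (hv : 0 ≤ μ v + δ)
    (hle : ∀ j, j ≠ v → (μ v + δ) * μ0 j ≤ Real.exp ε * (μ j * μ0 v) ∧
      μ j * μ0 v ≤ Real.exp ε * ((μ v + δ) * μ0 j)) :
    addMass μ v δ ∈ FeasibleSet (⊤ : SimpleGraph V) ε μ0 := by
  refine ⟨⟨fun w => div_nonneg ?_ hδ.le, ?_⟩, fun i j hij => ?_⟩
  · split_ifs with hw
    · rwa [hw]
    · simpa using h.1.1 w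
  · simp only [addMass]
    rw [← Finset.sum_div, Finset.sum_add_distrib, h.1.2]
    simp [hδ.ne']
  · simp only [addMass]
    rw [div_mul_eq_mul_div, div_mul_eq_mul_div, ← mul_div_assoc]
    refine div_le_div_of_nonneg_right ?_ hδ.le
    have hne : i ≠ j := by simpa using hij
    split_ifs with hi hj hj
    · exact absurd (hi.trans hj.symm) hne
    · subst hi
      simpa using (hle j hj).1
    · subst hj
      simpa using (hle i hi).2
    · simpa using h.2 i j hij

/-- At an extreme point, every state takes part in a binding constraint. -/
lemma exists_binding_of_isExtremePt {ε : ℝ} (hV : 2 ≤ Fintype.card V)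
    {μ0 μ : V → ℝ} (hpos : ∀ v, 0 < μ0 v)
    (h : IsExtremePt (FeasibleSet (⊤ : SimpleGraph V) ε μ0) μ) (v : V) :
    ∃ j, μ v * μ0 j = Real.exp ε * (μ j * μ0 v) ∨ μ j * μ0 v = Real.exp ε * (μ v * μ0 j) := by
  by_contra! hn
  have hμ := h.1
  have hevj : ∀ j, ∀ᶠ δ : ℝ in nhds 0, j ≠ v →
      (μ v + δ) * μ0 j ≤ Real.exp ε * (μ j * μ0 v) ∧
        μ j * μ0 v ≤ Real.exp ε * ((μ v + δ) * μ0 j) := fun j => by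
    by_cases hj : j = v
    · simp [hj]
    have h1 := lt_of_le_of_ne (hμ.2 v j (by simpa using Ne.symm hj)) (hn j).1
    have h2 := lt_of_le_of_ne (hμ.2 j v (by simpa using hj)) (hn j).2
    have c1 : ContinuousAt (fun δ : ℝ => (μ v + δ) * μ0 j) 0 := by fun_prop
    have c2 : ContinuousAt (fun δ : ℝ => Real.exp ε * ((μ v + δ) * μ0 j)) 0 := by fun_prop
    filter_upwards [c1.eventually_lt_const (by simpa using h1),
      c2.eventually_const_lt (by simpa using h2)] with δ e1 e2 _
    exact ⟨e1.le, e2.le⟩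
  have hvpos := pos_of_mem_feasibleSet_top hpos hμ v
  have hev : ∀ᶠ δ : ℝ in nhds 0, 0 < 1 + δ ∧ 0 < μ v + δ ∧ ∀ j, j ≠ v →
      (μ v + δ) * μ0 j ≤ Real.exp ε * (μ j * μ0 v) ∧
        μ j * μ0 v ≤ Real.exp ε * ((μ v + δ) * μ0 j) := by
    filter_upwards [lt_mem_nhds (show (-1 : ℝ) < 0 by norm_num),
      lt_mem_nhds (show -μ v < 0 by linarith), Filter.eventually_all.2 hevj] with δ e1 e2 e3
    exact ⟨by linarith, by linarith, e3⟩
  obtain ⟨r, hr, hball⟩ := Metric.eventually_nhds_iff.1 hev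
  have hr2 : 0 < r / 2 := half_pos hr
  obtain ⟨p1, p2, p3⟩ := hball (y := r / 2) (by
    rw [Real.dist_0_eq_abs, abs_of_pos hr2]; linarith)
  obtain ⟨q1, q2, q3⟩ := hball (y := -(r / 2)) (by
    rw [Real.dist_0_eq_abs, abs_neg, abs_of_pos hr2]; linarith)
  generalize r / 2 = δ at *
  refine h.2 ⟨addMass μ v δ, addMass μ v (-δ), addMass_mem_feasibleSet hμ p1 p2.le p3,
    addMass_mem_feasibleSet hμ q1 q2.le q3, fun heq => ?_, (1 + δ) / 2, by linarith,
    by linarith, ?_⟩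
  · have : Nontrivial V := Fintype.one_lt_card_iff_nontrivial.1 hV
    obtain ⟨j, hj⟩ := exists_ne v
    have hjpos := pos_of_mem_feasibleSet_top hpos hμ j
    have e := congrFun heq j
    simp only [addMass, hj, if_false] at e
    rw [div_eq_div_iff p1.ne' q1.ne'] at e
    have : μ j * δ = 0 := by linear_combination -e / 2
    exact (mul_pos hjpos hr2).ne' this
  · funext w
    simp only [addMass]
    have q1' : (1 : ℝ) + -δ ≠ 0 := q1.ne'
    have e : (1 : ℝ) - (1 + δ) / 2 = (1 + -δ) / 2 := by ring
    rw [e]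
    split_ifs <;> field_simp <;> ring

end

/-- Corollary: extreme posteriors for `ε`-inferential privacy.
For the complete graph `G*` on `Θ`, a distribution `μ` is an extreme point of the
feasible set `M` if and only if there is an ordered partition `(Θ₁, Θ₂)` of `Θ` into
two nonempty sets with `μ(θ) = e^ε·μ₀(θ)/(e^ε·μ₀(Θ₁) + μ₀(Θ₂))` on `Θ₁` and
`μ(θ) = μ₀(θ)/(e^ε·μ₀(Θ₁) + μ₀(Θ₂))` on `Θ₂`. -/
theorem stmt_5 {V : Type*} [Fintype V] [DecidableEq V]
    (hV : 2 ≤ Fintype.card V)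
    (ε : ℝ) (hε : 0 < ε) (μ0 : V → ℝ) (hμ0 : IsDist μ0) (hμ0pos : ∀ v, 0 < μ0 v)
    (μ : V → ℝ) (hμ : IsDist μ) :
    IsExtremePt (FeasibleSet (⊤ : SimpleGraph V) ε μ0) μ ↔
      ∃ A B : Finset V, A.Nonempty ∧ B.Nonempty ∧ Disjoint A B ∧
        A ∪ B = Finset.univ ∧
        (∀ θ ∈ A, μ θ = Real.exp ε * μ0 θ /
            (Real.exp ε * ∑ θ' ∈ A, μ0 θ' + ∑ θ' ∈ B, μ0 θ')) ∧
        (∀ θ ∈ B, μ θ = μ0 θ /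
            (Real.exp ε * ∑ θ' ∈ A, μ0 θ' + ∑ θ' ∈ B, μ0 θ')) := by
  have hc : 1 < Real.exp ε := Real.one_lt_exp_iff.2 hε
  have hc0 : 0 < Real.exp ε := Real.exp_pos ε
  constructor
  · intro h
    have hne : Nonempty V := Fintype.card_pos_iff.1 (by omega)
    obtain ⟨b, hb⟩ := Finite.exists_min fun v => μ v / μ0 v
    have hle := div_le_of_mem_feasibleSet_top hε hμ0pos h.1
    have hm : 0 < μ b / μ0 b := div_pos (pos_of_mem_feasibleSet_top hμ0pos h.1 b) (hμ0pos b)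
    have hbind : ∀ v, ∃ j, μ v / μ0 v = Real.exp ε * (μ j / μ0 j) ∨
        μ j / μ0 j = Real.exp ε * (μ v / μ0 v) := fun v => by
      obtain ⟨j, hj⟩ := exists_binding_of_isExtremePt hV hμ0pos h v
      have hv := hμ0pos v
      have hj' := hμ0pos j
      refine ⟨j, hj.imp (fun e => ?_) fun e => ?_⟩ <;>
      · field_simp
        linarith
    have htwo : ∀ v, μ v / μ0 v = Real.exp ε * (μ b / μ0 b) ∨ μ v / μ0 v = μ b / μ0 b := by
      intro v
      obtain ⟨j, hj | hj⟩ := hbind v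
      · exact .inl (le_antisymm (hle v b) (hj ▸ mul_le_mul_of_nonneg_left (hb j) hc0.le))
      · refine .inr (le_antisymm (le_of_mul_le_mul_left ?_ hc0) (hb v))
        exact hj ▸ hle j b
    have hlt : μ b / μ0 b < Real.exp ε * (μ b / μ0 b) := lt_mul_of_one_lt_left hm hc
    let A : Finset V := {v | μ v / μ0 v = Real.exp ε * (μ b / μ0 b)}
    let B : Finset V := {v | μ v / μ0 v = μ b / μ0 b}
    have hA : A.Nonempty := by
      obtain ⟨j, hj | hj⟩ := hbind b
      · have := mul_le_mul_of_nonneg_left (hb j) hc0.le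
        linarith
      · exact ⟨j, by simpa [A] using hj⟩
    have hB : B.Nonempty := ⟨b, by simp [B]⟩
    have hAB : Disjoint A B := by
      refine Finset.disjoint_left.2 fun v hvA hvB => hlt.ne' ?_
      simp only [A, B, Finset.mem_filter_univ] at hvA hvB
      exact hvA.symm.trans hvB
    have hU : A ∪ B = Finset.univ := by
      ext v
      simpa [A, B] using htwo v
    refine ⟨A, B, hA, hB, hAB, hU, eq_of_ratio_eq hc0 hμ0pos hμ hA hB hAB hU ?_⟩
    intro x hx y hy
    simp only [A, B, Finset.mem_filter_univ] at hx hy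
    rw [hx, hy]
  · rintro ⟨A, B, hA, hB, hAB, hU, hμA, hμB⟩
    have hD : 0 < Real.exp ε * ∑ v ∈ A, μ0 v + ∑ v ∈ B, μ0 v :=
      add_pos (mul_pos hc0 (Finset.sum_pos (fun v _ => hμ0pos v) hA))
        (Finset.sum_pos (fun v _ => hμ0pos v) hB)
    have hmem : ∀ v, v ∈ A ∨ v ∈ B := fun v => by
      rw [← Finset.mem_union, hU]
      exact Finset.mem_univ v
    set D := Real.exp ε * ∑ v ∈ A, μ0 v + ∑ v ∈ B, μ0 v
    have hrA : ∀ a ∈ A, μ a / μ0 a = Real.exp ε / D := fun a ha => by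
      have := hμ0pos a
      rw [hμA a ha]
      field_simp
    have hrB : ∀ b ∈ B, μ b / μ0 b = 1 / D := fun b hb => by
      have := hμ0pos b
      rw [hμB b hb]
      field_simp
    have hlow : ∀ v, 1 / D ≤ μ v / μ0 v := fun v => by
      rcases hmem v with hv | hv
      · rw [hrA v hv]
        exact div_le_div_of_nonneg_right hc.le hD.le
      · rw [hrB v hv]
    have hup : ∀ v, μ v / μ0 v ≤ Real.exp ε / D := fun v => by
      rcases hmem v with hv | hv
      · rw [hrA v hv]
      · rw [hrB v hv]
        exact div_le_div_of_nonneg_right hc.le hD.le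
    refine ⟨⟨hμ, fun i j _ => ?_⟩, ?_⟩
    · have key : μ i / μ0 i ≤ Real.exp ε * (μ j / μ0 j) :=
        calc μ i / μ0 i ≤ Real.exp ε / D := hup i
          _ = Real.exp ε * (1 / D) := by ring
          _ ≤ _ := mul_le_mul_of_nonneg_left (hlow j) hc0.le
      rw [← mul_div_assoc, div_le_div_iff₀ (hμ0pos i) (hμ0pos j)] at key
      linarith
    · rintro ⟨μ', μ'', h', h'', hne, α, hα0, hα1, hmix⟩
      have htight : ∀ a ∈ A, ∀ b ∈ B, μ' a / μ0 a = Real.exp ε * (μ' b / μ0 b) ∧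
          μ'' a / μ0 a = Real.exp ε * (μ'' b / μ0 b) := fun a ha b hb => by
        have e : μ a / μ0 a = Real.exp ε * (μ b / μ0 b) := by
          rw [hrA a ha, hrB b hb]
          ring
        have l' := div_le_of_mem_feasibleSet_top hε hμ0pos h' a b
        have l'' := div_le_of_mem_feasibleSet_top hε hμ0pos h'' a b
        have e0 : α * (Real.exp ε * (μ' b / μ0 b) - μ' a / μ0 a) +
            (1 - α) * (Real.exp ε * (μ'' b / μ0 b) - μ'' a / μ0 a) = 0 := by
          rw [hmix] at e
          linear_combination -e
        have n' := mul_nonneg hα0.le (sub_nonneg.2 l')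
        have n'' := mul_nonneg (sub_pos.2 hα1).le (sub_nonneg.2 l'')
        obtain ⟨z', z''⟩ := (add_eq_zero_iff_of_nonneg n' n'').1 e0
        exact ⟨(sub_eq_zero.1 ((mul_eq_zero.1 z').resolve_left hα0.ne')).symm,
          (sub_eq_zero.1 ((mul_eq_zero.1 z'').resolve_left (sub_pos.2 hα1).ne')).symm⟩
      obtain ⟨fA', fB'⟩ := eq_of_ratio_eq hc0 hμ0pos h'.1 hA hB hAB hU
        fun a ha b hb => (htight a ha b hb).1
      obtain ⟨fA'', fB''⟩ := eq_of_ratio_eq hc0 hμ0pos h''.1 hA hB hAB hU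
        fun a ha b hb => (htight a ha b hb).2
      refine hne (funext fun v => ?_)
      rcases hmem v with hv | hv
      · rw [fA' v hv, fA'' v hv]
      · rw [fB' v hv, fB'' v hv]
end
end
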